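/- arXiv:2306.13641 — 2 statements merged into one kernel-verified Lean document; each statement's English description precedes it below -/
import Mathlib

section
/- Let (X, 𝒜, μ) be a σ-finite measure space and let p, q : X → [0,∞) be probability densities with respect to μ. Then the function x ↦ p(x)·log(p(x)/(p(x)+q(x))) + q(x)·log(q(x)/(p(x)+q(x))), taken to be 0 on {p+q = 0}, is μ-integrable, its integral satisfies ∫ (p log(p/(p+q)) + q log(q/(p+q))) dμ ≥ −log 4, and equality holds if and only if p = q μ-almost everywhere. -/
open MeasureTheory Real

/-- Tangent-line bound for `a * log (a / s)` at `a = s / 2`, strict away from that point. -/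
lemma sub_half_lt_mul_log_div {a s : ℝ} (ha : 0 ≤ a) (has : a ≤ s) (hne : s ≠ 2 * a) :
    a - s / 2 < a * log (a / s) + a * log 2 := by
  rcases ha.eq_or_lt with rfl | ha
  · have : 0 < s := lt_of_le_of_ne has (by simpa using hne.symm)
    simp only [zero_mul]
    linarith
  · have hs : 0 < s := ha.trans_le has
    have hlog := log_lt_sub_one_of_pos (x := s / (2 * a)) (by positivity)
      (by rwa [ne_eq, div_eq_one_iff_eq (by positivity)])
    rw [log_div hs.ne' (by positivity), log_mul two_ne_zero ha.ne'] at hlog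
    rw [log_div ha.ne' hs.ne']
    have hmul := mul_lt_mul_of_pos_left hlog ha
    have hsimp : a * (s / (2 * a) - 1) = s / 2 - a := by field_simp
    linarith

lemma mul_log_div_add_self (a : ℝ) : a * log (a / (a + a)) + a * log 2 = 0 := by
  rcases eq_or_ne a 0 with rfl | ha
  · simp
  · rw [← two_mul, show a / (2 * a) = 2⁻¹ by field_simp, log_inv]
    ring

/-- The discriminator integrand, shifted by its value at `a = b`, is nonnegative. -/
lemma discriminator_integrand_shift_nonneg {a b : ℝ} (ha : 0 ≤ a) (hb : 0 ≤ b) :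
    0 ≤ a * log (a / (a + b)) + b * log (b / (a + b)) + (a + b) * log 2 := by
  by_cases hab : a = b
  · subst hab
    have := mul_log_div_add_self a
    linarith
  · have h₁ := sub_half_lt_mul_log_div ha (le_add_of_nonneg_right hb)
      (fun h => hab (by linarith))
    have h₂ := sub_half_lt_mul_log_div hb (le_add_of_nonneg_left ha)
      (fun h => hab (by linarith))
    linarith

lemma discriminator_integrand_shift_eq_zero_iff {a b : ℝ} (ha : 0 ≤ a) (hb : 0 ≤ b) :
    a * log (a / (a + b)) + b * log (b / (a + b)) + (a + b) * log 2 = 0 ↔ a = b := by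
  refine ⟨fun h => ?_, ?_⟩
  · by_contra hab
    have h₁ := sub_half_lt_mul_log_div ha (le_add_of_nonneg_right hb)
      (fun h => hab (by linarith))
    have h₂ := sub_half_lt_mul_log_div hb (le_add_of_nonneg_left ha)
      (fun h => hab (by linarith))
    linarith
  · rintro rfl
    have := mul_log_div_add_self a
    linarith

lemma discriminator_integrand_nonpos {a b : ℝ} (ha : 0 ≤ a) (hb : 0 ≤ b) :
    a * log (a / (a + b)) + b * log (b / (a + b)) ≤ 0 :=
  add_nonpos
    (mul_nonpos_of_nonneg_of_nonpos ha (log_nonpos (by positivity)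
      (div_le_one_of_le₀ (by linarith) (by positivity))))
    (mul_nonpos_of_nonneg_of_nonpos hb (log_nonpos (by positivity)
      (div_le_one_of_le₀ (by linarith) (by positivity))))

/-- For probability densities `p`, `q` w.r.t. a σ-finite measure `μ`, the optimal
discriminator value integrand `p log(p/(p+q)) + q log(q/(p+q))` is integrable, its integral is
at least `−log 4`, with equality iff `p = q` μ-a.e. -/
theorem optimal_discriminator_value_geq_neg_log_four
    {X : Type*} [MeasurableSpace X] (μ : Measure X) [SigmaFinite μ]
    (p q : X → ℝ) (hpm : Measurable p) (hqm : Measurable q)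
    (hp0 : ∀ x, 0 ≤ p x) (hq0 : ∀ x, 0 ≤ q x)
    (hp1 : ∫ x, p x ∂μ = 1) (hq1 : ∫ x, q x ∂μ = 1) :
    Integrable
        (fun x => p x * log (p x / (p x + q x)) + q x * log (q x / (p x + q x))) μ ∧
      -log 4 ≤ ∫ x, (p x * log (p x / (p x + q x)) + q x * log (q x / (p x + q x))) ∂μ ∧
      (∫ x, (p x * log (p x / (p x + q x)) + q x * log (q x / (p x + q x))) ∂μ = -log 4 ↔
        p =ᵐ[μ] q) := by
  have hp : Integrable p μ := integrable_of_integral_eq_one hp1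
  have hq : Integrable q μ := integrable_of_integral_eq_one hq1
  have hdom : Integrable (fun x => (p x + q x) * log 2) μ := (hp.add hq).mul_const _
  have hint : Integrable
      (fun x => p x * log (p x / (p x + q x)) + q x * log (q x / (p x + q x))) μ := by
    refine hdom.mono' (by fun_prop) (.of_forall fun x => ?_)
    rw [norm_of_nonpos (discriminator_integrand_nonpos (hp0 x) (hq0 x))]
    linarith [discriminator_integrand_shift_nonneg (hp0 x) (hq0 x)]
  have hnonneg : 0 ≤ fun x => p x * log (p x / (p x + q x)) + q x * log (q x / (p x + q x)) +
      (p x + q x) * log 2 :=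
    fun x => discriminator_integrand_shift_nonneg (hp0 x) (hq0 x)
  have hlog : log 4 = 2 * log 2 := by
    rw [show (4 : ℝ) = 2 ^ 2 by norm_num, log_pow, Nat.cast_ofNat]
  have hsum : ∫ x, (p x * log (p x / (p x + q x)) + q x * log (q x / (p x + q x)) +
      (p x + q x) * log 2) ∂μ =
      ∫ x, (p x * log (p x / (p x + q x)) + q x * log (q x / (p x + q x))) ∂μ + log 4 := by
    rw [integral_add hint hdom, integral_mul_const, integral_add hp hq, hp1, hq1, hlog]
    norm_num
  refine ⟨hint, ?_, ?_⟩
  · linarith [integral_nonneg (μ := μ) hnonneg]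
  · rw [eq_neg_iff_add_eq_zero, ← hsum, integral_eq_zero_iff_of_nonneg hnonneg (hint.add hdom)]
    exact Filter.eventually_congr (.of_forall fun x =>
      discriminator_integrand_shift_eq_zero_iff (hp0 x) (hq0 x))
end

section
/- Let (X, 𝒜, μ) be a σ-finite measure space and let p : X → [0,∞) be a probability density with respect to μ. For each probability density q with respect to μ, define V(q) = ∫ (p log(p/(p+q)) + q log(q/(p+q))) dμ, with the integrand taken to be 0 on {p+q = 0}. Then the infimum of V(q) over all probability densities q with respect to μ equals −log 4; this infimum is attained at q = p, and V(q) = −log 4 holds if and only if q = p μ-almost everywhere. -/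
open MeasureTheory Real

lemma mul_log_div_add_eq {a b : ℝ} (ha : 0 < a) (hb : 0 ≤ b) :
    a * log (a / (a + b)) = -a * log 2 - a * log ((a + b) / (2 * a)) := by
  have hab : 0 < a + b := by linarith
  rw [log_div ha.ne' hab.ne', log_div hab.ne' (by positivity), log_mul two_ne_zero ha.ne']
  ring

lemma le_mul_log_div_add {a b : ℝ} (ha : 0 ≤ a) (hb : 0 ≤ b) :
    (a - b) / 2 - a * log 2 ≤ a * log (a / (a + b)) := by
  rcases ha.eq_or_lt with rfl | ha
  · simp; linarith
  · have hab : 0 < (a + b) / (2 * a) := by positivity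
    have h := mul_le_mul_of_nonneg_left (log_le_sub_one_of_pos hab) ha.le
    have e : a * ((a + b) / (2 * a) - 1) = (b - a) / 2 := by field_simp; ring
    rw [mul_log_div_add_eq ha hb]
    linarith

lemma lt_mul_log_div_add {a b : ℝ} (ha : 0 ≤ a) (hb : 0 ≤ b) (hne : a ≠ b) :
    (a - b) / 2 - a * log 2 < a * log (a / (a + b)) := by
  rcases ha.eq_or_lt with rfl | ha
  · have : 0 < b := lt_of_le_of_ne hb hne
    simp; linarith
  · have hab : 0 < (a + b) / (2 * a) := by positivity
    have hne' : (a + b) / (2 * a) ≠ 1 := by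
      intro h
      rw [div_eq_one_iff_eq (by positivity)] at h
      exact hne (by linarith)
    have h := mul_lt_mul_of_pos_left (log_lt_sub_one_of_pos hab hne') ha
    have e : a * ((a + b) / (2 * a) - 1) = (b - a) / 2 := by field_simp; ring
    rw [mul_log_div_add_eq ha hb]
    linarith

lemma mul_log_div_add_nonpos {a b : ℝ} (ha : 0 ≤ a) (hb : 0 ≤ b) :
    a * log (a / (a + b)) ≤ 0 :=
  mul_nonpos_of_nonneg_of_nonpos ha
    (log_nonpos (by positivity) (div_le_one_of_le₀ (by linarith) (by positivity)))

/-- The integrand of the optimal discriminator value, as a function of the two densities. -/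
noncomputable def discriminatorIntegrand (a b : ℝ) : ℝ :=
  a * log (a / (a + b)) + b * log (b / (a + b))

lemma discriminatorIntegrand_nonpos {a b : ℝ} (ha : 0 ≤ a) (hb : 0 ≤ b) :
    discriminatorIntegrand a b ≤ 0 := by
  have h₁ := mul_log_div_add_nonpos ha hb
  have h₂ := mul_log_div_add_nonpos hb ha
  rw [add_comm b a] at h₂
  exact add_nonpos h₁ h₂

lemma discriminatorIntegrand_add_nonneg {a b : ℝ} (ha : 0 ≤ a) (hb : 0 ≤ b) :
    0 ≤ discriminatorIntegrand a b + (a + b) * log 2 := by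
  have h₁ := le_mul_log_div_add ha hb
  have h₂ := le_mul_log_div_add hb ha
  rw [add_comm b a] at h₂
  unfold discriminatorIntegrand
  linarith

lemma discriminatorIntegrand_self (a : ℝ) :
    discriminatorIntegrand a a + (a + a) * log 2 = 0 := by
  rcases eq_or_ne a 0 with rfl | ha
  · simp [discriminatorIntegrand]
  · have h : a / (a + a) = 2⁻¹ := by field_simp; norm_num
    rw [discriminatorIntegrand, h, log_inv]
    ring

lemma discriminatorIntegrand_add_eq_zero_iff {a b : ℝ} (ha : 0 ≤ a) (hb : 0 ≤ b) :
    discriminatorIntegrand a b + (a + b) * log 2 = 0 ↔ b = a := by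
  refine ⟨fun h => ?_, fun h => h ▸ discriminatorIntegrand_self b⟩
  by_contra hne
  have h₁ := lt_mul_log_div_add ha hb (Ne.symm hne)
  have h₂ := lt_mul_log_div_add hb ha hne
  rw [add_comm b a] at h₂
  unfold discriminatorIntegrand at h
  linarith

section Integral

variable {X : Type*} [MeasurableSpace X] {μ : Measure X} {p q : X → ℝ}

lemma integrable_discriminatorIntegrand (hpm : Measurable p) (hp0 : ∀ x, 0 ≤ p x)
    (hp : Integrable p μ) (hqm : Measurable q) (hq0 : ∀ x, 0 ≤ q x) (hq : Integrable q μ) :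
    Integrable (fun x => discriminatorIntegrand (p x) (q x)) μ := by
  refine ((hp.add hq).mul_const (log 2)).mono' ?_ (ae_of_all _ fun x => ?_)
  · unfold discriminatorIntegrand
    exact (by fun_prop : Measurable _).aestronglyMeasurable
  · have h := discriminatorIntegrand_add_nonneg (hp0 x) (hq0 x)
    rw [norm_eq_abs, abs_of_nonpos (discriminatorIntegrand_nonpos (hp0 x) (hq0 x))]
    simp only [Pi.add_apply]
    linarith

lemma integral_discriminatorIntegrand_eq (hpm : Measurable p) (hp0 : ∀ x, 0 ≤ p x)
    (hp1 : ∫ x, p x ∂μ = 1) (hqm : Measurable q) (hq0 : ∀ x, 0 ≤ q x)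
    (hq1 : ∫ x, q x ∂μ = 1) :
    Integrable (fun x => discriminatorIntegrand (p x) (q x) + (p x + q x) * log 2) μ ∧
    ∫ x, discriminatorIntegrand (p x) (q x) ∂μ =
      -log 4 + ∫ x, (discriminatorIntegrand (p x) (q x) + (p x + q x) * log 2) ∂μ := by
  have hp : Integrable p μ := .of_integral_ne_zero (by simp [hp1])
  have hq : Integrable q μ := .of_integral_ne_zero (by simp [hq1])
  have hF := integrable_discriminatorIntegrand hpm hp0 hp hqm hq0 hq
  have hG : Integrable (fun x => (p x + q x) * log 2) μ := (hp.add hq).mul_const _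
  refine ⟨hF.add hG, ?_⟩
  have h4 : log 4 = 2 * log 2 := by
    rw [show (4 : ℝ) = 2 ^ 2 by norm_num, log_pow]
    norm_num
  rw [integral_add hF hG, integral_mul_const, integral_add hp hq, hp1, hq1, h4]
  ring

lemma neg_log_four_le_integral_discriminatorIntegrand (hpm : Measurable p)
    (hp0 : ∀ x, 0 ≤ p x) (hp1 : ∫ x, p x ∂μ = 1) (hqm : Measurable q) (hq0 : ∀ x, 0 ≤ q x)
    (hq1 : ∫ x, q x ∂μ = 1) :
    -log 4 ≤ ∫ x, discriminatorIntegrand (p x) (q x) ∂μ := by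
  rw [(integral_discriminatorIntegrand_eq hpm hp0 hp1 hqm hq0 hq1).2]
  exact le_add_of_nonneg_right
    (integral_nonneg fun x => discriminatorIntegrand_add_nonneg (hp0 x) (hq0 x))

lemma integral_discriminatorIntegrand_eq_neg_log_four_iff (hpm : Measurable p)
    (hp0 : ∀ x, 0 ≤ p x) (hp1 : ∫ x, p x ∂μ = 1) (hqm : Measurable q) (hq0 : ∀ x, 0 ≤ q x)
    (hq1 : ∫ x, q x ∂μ = 1) :
    ∫ x, discriminatorIntegrand (p x) (q x) ∂μ = -log 4 ↔ q =ᵐ[μ] p := by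
  obtain ⟨hint, heq⟩ := integral_discriminatorIntegrand_eq hpm hp0 hp1 hqm hq0 hq1
  rw [heq, add_eq_left, integral_eq_zero_iff_of_nonneg
    (fun x => discriminatorIntegrand_add_nonneg (hp0 x) (hq0 x)) hint]
  exact Filter.eventually_congr
    (ae_of_all _ fun x => discriminatorIntegrand_add_eq_zero_iff (hp0 x) (hq0 x))

end Integral

/-- The infimum over probability densities `q` of the optimal discriminator value
`V(q) = ∫ (p log(p/(p+q)) + q log(q/(p+q))) dμ` equals `−log 4`; it is attained at `q = p`,
and `V(q) = −log 4` iff `q = p` μ-a.e. -/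
theorem minimax_game_value
    {X : Type*} [MeasurableSpace X] (μ : Measure X) [SigmaFinite μ]
    (p : X → ℝ) (hpm : Measurable p) (hp0 : ∀ x, 0 ≤ p x) (hp1 : ∫ x, p x ∂μ = 1) :
    IsGLB {v : ℝ | ∃ q : X → ℝ, Measurable q ∧ (∀ x, 0 ≤ q x) ∧ (∫ x, q x ∂μ = 1) ∧
        v = ∫ x, (p x * log (p x / (p x + q x)) + q x * log (q x / (p x + q x))) ∂μ}
      (-log 4) ∧
    ∫ x, (p x * log (p x / (p x + p x)) + p x * log (p x / (p x + p x))) ∂μ = -log 4 ∧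
    ∀ q : X → ℝ, Measurable q → (∀ x, 0 ≤ q x) → (∫ x, q x ∂μ = 1) →
      ((∫ x, (p x * log (p x / (p x + q x)) + q x * log (q x / (p x + q x))) ∂μ = -log 4) ↔
        q =ᵐ[μ] p) := by
  have hself : ∫ x, discriminatorIntegrand (p x) (p x) ∂μ = -log 4 :=
    (integral_discriminatorIntegrand_eq_neg_log_four_iff hpm hp0 hp1 hpm hp0 hp1).2 .rfl
  refine ⟨IsLeast.isGLB ⟨⟨p, hpm, hp0, hp1, hself.symm⟩, ?_⟩, hself, fun q hqm hq0 hq1 =>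
    integral_discriminatorIntegrand_eq_neg_log_four_iff hpm hp0 hp1 hqm hq0 hq1⟩
  rintro v ⟨q, hqm, hq0, hq1, rfl⟩
  exact neg_log_four_le_integral_discriminatorIntegrand hpm hp0 hp1 hqm hq0 hq1
end
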